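/- Let 𝕋 be a two-graph on a countably infinite vertex set such that every finite two-graph is isomorphic to an induced sub-two-graph of 𝕋 and every isomorphism between finite induced sub-two-graphs of 𝕋 extends to an automorphism of 𝕋. Then the automorphism group Aut(𝕋) contains a subgroup H that is locally finite (every finitely generated subgroup of H is finite) and dense in Aut(𝕋): for every automorphism g of 𝕋 and every finite set F of vertices of 𝕋 there exists h ∈ H with h(x) = g(x) for all x ∈ F. -/

import Mathlib

open scoped Classical in
/-- Classical indicator of a proposition. -/
noncomputable def indic (P : Prop) : ℕ := if P then 1 else 0

/-- The three-element set `{a, b, c}` (as a `Finset`), defined classically. -/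
noncomputable def tri {V : Type} (a b c : V) : Finset V :=
  letI := Classical.decEq V
  {a, b, c}

/-- A two-graph (on a possibly infinite vertex set): a set of 3-element
hyperedges such that every four distinct vertices carry an even number of
hyperedges. -/
def IsTwoGraphSet {V : Type} (T : Set (Finset V)) : Prop :=
  (∀ t ∈ T, t.card = 3) ∧
  ∀ a b c d : V, a ≠ b → a ≠ c → a ≠ d → b ≠ c → b ≠ d → c ≠ d →
    Even (indic (tri a b c ∈ T) + indic (tri a b d ∈ T) +
      indic (tri a c d ∈ T) + indic (tri b c d ∈ T))

/-- `g` is an automorphism of the two-graph `(V, T)`. -/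
def IsTGAut {V : Type} (T : Set (Finset V)) (g : Equiv.Perm V) : Prop :=
  ∀ a b c : V, tri (g a) (g b) (g c) ∈ T ↔ tri a b c ∈ T

/-- A partial isomorphism between induced sub-two-graphs of `(V, T)`,
represented by its graph `p ⊆ V × V`. -/
def IsPartialTGIso {V : Type} (T : Set (Finset V)) (p : Set (V × V)) : Prop :=
  (∀ u ∈ p, ∀ v ∈ p, (u.1 = v.1 ↔ u.2 = v.2)) ∧
  (∀ u ∈ p, ∀ v ∈ p, ∀ w ∈ p, (tri u.1 v.1 w.1 ∈ T ↔ tri u.2 v.2 w.2 ∈ T))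

/-- The coboundary of a symmetric `ZMod 2`-valued function: the hyperedge indicator of the
two-graph of the graph `ε`. -/
def coboundary {X : Type} (ε : X → X → ZMod 2) (a b c : X) : ZMod 2 :=
  ε a b + ε b c + ε a c

/-- `ε` is the adjacency function of a simple graph. -/
structure IsGraphFun {X : Type} (ε : X → X → ZMod 2) : Prop where
  symm : ∀ a b, ε a b = ε b a
  diag : ∀ a, ε a a = 0

/-- `f` preserves the two-graphs of the graphs `ε` and `ε'`. -/
def PreservesCoboundary {X Y : Type} (ε : X → X → ZMod 2) (ε' : Y → Y → ZMod 2)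
    (f : X → Y) : Prop :=
  ∀ a b c, coboundary ε' (f a) (f b) (f c) = coboundary ε a b c

lemma PreservesCoboundary.comp {X Y Z : Type} {ε : X → X → ZMod 2} {ε' : Y → Y → ZMod 2}
    {ε'' : Z → Z → ZMod 2} {g : Y → Z} {f : X → Y} (hg : PreservesCoboundary ε' ε'' g)
    (hf : PreservesCoboundary ε ε' f) : PreservesCoboundary ε ε'' (g ∘ f) :=
  fun a b c => (hg _ _ _).trans (hf a b c)

/-- Switching equivalent graphs have the same two-graph. -/
lemma PreservesCoboundary.of_switching {X Y : Type} {ε : X → X → ZMod 2}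
    {ε' : Y → Y → ZMod 2} {f : X → Y} (c : X → ZMod 2)
    (h : ∀ a b, ε' (f a) (f b) = ε a b + c a + c b) : PreservesCoboundary ε ε' f := by
  intro x y z
  simp only [coboundary, h]
  grind

/-- Graphs with the same two-graph are switching equivalent. -/
lemma PreservesCoboundary.exists_switching {X Y : Type} {ε : X → X → ZMod 2}
    {ε' : Y → Y → ZMod 2} {f : X → Y} (h : PreservesCoboundary ε ε' f) :
    ∃ c : X → ZMod 2, ∀ a b, ε' (f a) (f b) = ε a b + c a + c b := by
  rcases isEmpty_or_nonempty X with _ | ⟨⟨o⟩⟩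
  · exact ⟨0, fun a => isEmptyElim a⟩
  · refine ⟨fun x => ε' (f o) (f x) + ε o x, fun a b => ?_⟩
    have := h o a b
    simp only [coboundary] at this
    grind

lemma IsGraphFun.coboundary_eq_zero {X : Type} {ε : X → X → ZMod 2} (hε : IsGraphFun ε)
    {a b c : X} (h : ¬(a ≠ b ∧ a ≠ c ∧ b ≠ c)) : coboundary ε a b c = 0 := by
  have h1 := hε.diag a
  have h2 := hε.diag b
  have h3 := hε.symm a b
  have h4 := hε.symm b c
  simp only [coboundary]
  grind

/-- The extension graph of `ε`, with vertices the pairs of a vertex and a vertex labelling. -/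
def extGraph {M : Type} (ε : M → M → ZMod 2) (p q : M × (M → ZMod 2)) : ZMod 2 :=
  p.2 q.1 + q.2 p.1 + ε p.1 q.1

lemma IsGraphFun.extGraph {M : Type} {ε : M → M → ZMod 2} (hε : IsGraphFun ε) :
    IsGraphFun (extGraph ε) where
  symm p q := by
    have := hε.symm p.1 q.1
    simp only [_root_.extGraph]
    grind
  diag p := by
    have := hε.diag p.1
    simp only [_root_.extGraph]
    grind

/-- Permutations of `M` act on the vertices of an extension graph. -/
def extPerm (M : Type) : Equiv.Perm M →* Equiv.Perm (M × (M → ZMod 2)) where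
  toFun k :=
    { toFun := fun p => (k p.1, p.2 ∘ k.symm)
      invFun := fun p => (k.symm p.1, p.2 ∘ k)
      left_inv := fun p => by ext <;> simp
      right_inv := fun p => by ext <;> simp }
  map_one' := rfl
  map_mul' _ _ := rfl

@[simp] lemma extPerm_apply {M : Type} (k : Equiv.Perm M) (p : M × (M → ZMod 2)) :
    extPerm M k p = (k p.1, p.2 ∘ k.symm) := rfl

lemma PreservesCoboundary.extPerm {M : Type} {ε : M → M → ZMod 2} {k : Equiv.Perm M}
    (hk : PreservesCoboundary ε ε k) :
    PreservesCoboundary (extGraph ε) (extGraph ε) (extPerm M k) := by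
  obtain ⟨c, hc⟩ := hk.exists_switching
  refine .of_switching (fun p => c p.1) fun p q => ?_
  simp only [extGraph, extPerm_apply, Function.comp_apply, Equiv.symm_apply_apply, hc]
  ring

/-- A partial automorphism of the two-graph of `ε` extends to an automorphism of the two-graph
of the extension graph. -/
lemma exists_extGraph_automorphism {M : Type} [Finite M] {ε : M → M → ZMod 2}
    (hε : IsGraphFun ε) (D : Set M) (f : M → M) (hf : Set.InjOn f D) (c : M → ZMod 2)
    (hc : ∀ x ∈ D, ∀ y ∈ D, ε (f x) (f y) = ε x y + c x + c y) :
    ∃ h : Equiv.Perm (M × (M → ZMod 2)),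
      PreservesCoboundary (extGraph ε) (extGraph ε) h ∧ ∀ x ∈ D, h (x, 0) = (f x, 0) := by
  classical
  have := Fintype.ofFinite M
  obtain ⟨π, hπ⟩ : ∃ π : Equiv.Perm M, ∀ x ∈ D, π x = f x := by
    obtain ⟨g, hg⟩ := Set.MapsTo.exists_equiv_extend_of_card_eq (t := Finset.univ) rfl
      (s := D) (f := f) (by simp [Set.MapsTo]) hf
    exact ⟨g.trans (Equiv.subtypeUnivEquiv (by simp)), hg⟩
  obtain ⟨e⟩ : Nonempty (M ↪ ℕ) := ⟨(Fintype.equivFin M).toEmbedding.trans Fin.valEmbedding⟩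
  let d : M → M → ZMod 2 := fun x y => ε (π x) (π y) + ε x y + c x + c y
  let v : M → M → ZMod 2 := fun x y => if x ∈ D then 0 else if y ∈ D ∨ e y < e x then d x y else 0
  have hv : ∀ x y, v x y + v y x = d x y := by
    intro x y
    have hsymm : d y x = d x y := by
      have h1 := hε.symm x y
      have h2 := hε.symm (π x) (π y)
      grind
    have hD : x ∈ D → y ∈ D → d x y = 0 := by
      intro hx hy
      have := hc x hx y hy
      simp only [d, hπ x hx, hπ y hy]
      grind
    have hdiag : x = y → d x y = 0 := by
      rintro rfl
      have h1 := hε.diag x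
      have h2 := hε.diag (π x)
      grind
    have hinj : e x = e y → x = y := fun h => e.injective h
    simp only [v, hsymm]
    rcases lt_trichotomy (e x) (e y) with h | h | h <;> by_cases hx : x ∈ D <;>
      by_cases hy : y ∈ D <;> simp_all [not_lt_of_gt]
  refine ⟨{ toFun := fun p => (π p.1, fun y => p.2 (π.symm y) + v p.1 (π.symm y))
            invFun := fun p => (π.symm p.1, fun y => p.2 (π y) + v (π.symm p.1) y)
            left_inv := fun p => ?_
            right_inv := fun p => ?_ }, ?_, ?_⟩
  · ext y
    · simp
    · simp only [Equiv.symm_apply_apply]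
      grind
  · ext y
    · simp
    · simp only [Equiv.apply_symm_apply]
      grind
  · refine .of_switching (fun p => c p.1) fun p q => ?_
    have := hv p.1 q.1
    simp only [extGraph, Equiv.coe_fn_mk, Equiv.symm_apply_apply]
    grind
  · intro x hx
    ext y
    · exact hπ x hx
    · simp [v, hx]

/-- Every one-point extension of the two-graph of `ε` embeds in the two-graph of the extension
graph. -/
lemma exists_extGraph_type {M : Type} [Nonempty M] (ε : M → M → ZMod 2) (f : M → ZMod 2) :
    ∃ (w : M × (M → ZMod 2)) (a : ZMod 2), w.2 ≠ 0 ∧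
      ∀ y, extGraph ε w (y, 0) = f y + a := by
  obtain ⟨o⟩ := ‹Nonempty M›
  refine ⟨(o, fun y => f y + ε o y + (1 + f o + ε o o)), 1 + f o + ε o o, fun h => ?_,
    fun y => ?_⟩
  · have := congrFun h o
    simp only [Pi.zero_apply] at this
    grind
  · simp only [extGraph, Pi.zero_apply]
    grind

lemma tri_eq_iff {V : Type} (s : Finset V) (a b c : V) :
    s = tri a b c ↔ ∀ x, x ∈ s ↔ x = a ∨ x = b ∨ x = c := by
  classical
  simp [tri, Finset.ext_iff]

lemma card_tri_eq_three {V : Type} {a b c : V} :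
    (tri a b c).card = 3 ↔ a ≠ b ∧ a ≠ c ∧ b ≠ c := by
  classical
  constructor
  · intro h
    have hle : ∀ x y, tri a b c ⊆ {x, y} → False := fun x y hs => by
      have := (Finset.card_le_card hs).trans Finset.card_le_two
      omega
    refine ⟨?_, ?_, ?_⟩ <;> rintro rfl
    · exact hle a c (by simp [tri])
    · exact hle a b (by intro; simp [tri]; tauto)
    · exact hle a b (by simp [tri])
  · rintro ⟨h1, h2, h3⟩
    simp only [tri]
    rw [Finset.card_eq_three]
    exact ⟨a, b, c, h1, h2, h3, by ext; simp⟩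

/-- Every two-graph is the two-graph of a graph. -/
lemma IsTwoGraphSet.exists_graphFun {V : Type} [Nonempty V] {T : Set (Finset V)}
    (hT : IsTwoGraphSet T) : ∃ ε : V → V → ZMod 2, IsGraphFun ε ∧
      ∀ a b c, tri a b c ∈ T ↔ coboundary ε a b c = 1 := by
  classical
  obtain ⟨o⟩ := ‹Nonempty V›
  have hcomm₁ : ∀ a b c : V, tri a b c = tri b a c := fun a b c => by
    rw [tri_eq_iff]; simp [tri]; grind
  have hcomm₂ : ∀ a b c : V, tri a b c = tri a c b := fun a b c => by
    rw [tri_eq_iff]; simp [tri]; grind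
  have hne : ∀ a b c : V, ¬(a ≠ b ∧ a ≠ c ∧ b ≠ c) → tri a b c ∉ T :=
    fun a b c h hmem => h (card_tri_eq_three.1 (hT.1 _ hmem))
  let ε : V → V → ZMod 2 := fun a b => indic (tri o a b ∈ T)
  have hε : IsGraphFun ε :=
    ⟨fun a b => by simp only [ε, hcomm₂ o a b], fun a => by
      simp only [ε, indic, if_neg (hne o a a (by simp)), Nat.cast_zero]⟩
  have hεo : ∀ a, ε o a = 0 := fun a => by
      simp only [ε, indic, if_neg (hne o o a (by simp)), Nat.cast_zero]
  have hind : ∀ P : Prop, P ↔ (indic P : ZMod 2) = 1 := fun P => by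
    by_cases h : P <;> simp [indic, h]
  refine ⟨ε, hε, fun a b c => ?_⟩
  by_cases hd : a ≠ b ∧ a ≠ c ∧ b ≠ c
  swap
  · simp [hε.coboundary_eq_zero hd, hne a b c hd]
  have ha := hεo a
  have hb := hεo b
  have hc := hεo c
  have hab := hε.symm a b
  have hac := hε.symm a c
  rw [hind (tri a b c ∈ T)]
  suffices h : (indic (tri a b c ∈ T) : ZMod 2) = coboundary ε a b c by rw [h]
  have hbase : ∀ x y, ε x y = indic (tri o x y ∈ T) := fun _ _ => rfl
  by_cases hoa : o = a
  · subst hoa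
    rw [← hbase]
    simp only [coboundary]
    grind
  by_cases hob : o = b
  · subst hob
    rw [hcomm₁, ← hbase]
    simp only [coboundary]
    grind
  by_cases hoc : o = c
  · subst hoc
    rw [hcomm₂, hcomm₁, ← hbase]
    simp only [coboundary]
    grind
  have h4 := (ZMod.natCast_eq_zero_iff_even).2 (hT.2 o a b c hoa hob hoc hd.1 hd.2.1 hd.2.2)
  push_cast [← hbase] at h4
  simp only [coboundary]
  grind

/-- The two-graph of a graph, as a set of triples. -/
lemma IsGraphFun.exists_isTwoGraphSet {W : Type} {ε : W → W → ZMod 2} (hε : IsGraphFun ε) :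
    ∃ T : Set (Finset W), IsTwoGraphSet T ∧
      ∀ a b c, tri a b c ∈ T ↔ coboundary ε a b c = 1 := by
  classical
  have key : ∀ a b c : W, tri a b c ∈ {s : Finset W | ∃ a b c, a ≠ b ∧ a ≠ c ∧ b ≠ c ∧
      s = tri a b c ∧ coboundary ε a b c = 1} ↔ coboundary ε a b c = 1 := by
    intro a b c
    constructor
    · rintro ⟨x, y, z, hxy, hxz, hyz, h, h1⟩
      rw [tri_eq_iff] at h
      simp only [tri, Finset.mem_insert, Finset.mem_singleton] at h
      have hx := (h x).2 (by simp)
      have hy := (h y).2 (by simp)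
      have hz := (h z).2 (by simp)
      have h2 := hε.symm a b
      have h3 := hε.symm a c
      have h4 := hε.symm b c
      rw [← h1]
      simp only [coboundary]
      clear h h1
      rcases hx with rfl | rfl | rfl <;> rcases hy with rfl | rfl | rfl <;>
        rcases hz with rfl | rfl | rfl <;> first | contradiction | grind
    · intro h
      have hd : a ≠ b ∧ a ≠ c ∧ b ≠ c := by
        by_contra hd
        simp [hε.coboundary_eq_zero hd] at h
      exact ⟨a, b, c, hd.1, hd.2.1, hd.2.2, rfl, h⟩
  refine ⟨_, ⟨?_, ?_⟩, key⟩
  · rintro _ ⟨a, b, c, hab, hac, hbc, rfl, -⟩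
    exact card_tri_eq_three.2 ⟨hab, hac, hbc⟩
  · intro a b c d _ _ _ _ _ _
    have hind : ∀ x y z : W, (indic (coboundary ε x y z = 1) : ZMod 2) = coboundary ε x y z := by
      intro x y z
      generalize coboundary ε x y z = t
      rcases (by decide +revert : t = 0 ∨ t = 1) with rfl | rfl <;> simp [indic]
    simp only [key]
    rw [← ZMod.natCast_eq_zero_iff_even]
    push_cast [hind]
    simp only [coboundary]
    grind

lemma zmod_two_eq_iff (a b : ZMod 2) : a = b ↔ (a = 1 ↔ b = 1) := by
  revert a b
  decide

/-- The automorphism group of the two-graph of the graph `ε`. -/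
def coboundaryAut {X : Type} (ε : X → X → ZMod 2) : Subgroup (Equiv.Perm X) where
  carrier := {k | PreservesCoboundary ε ε k}
  one_mem' _ _ _ := rfl
  mul_mem' {k l} hk hl :=
    PreservesCoboundary.comp (f := l) (g := k) (Set.mem_ofPred.1 hk) (Set.mem_ofPred.1 hl)
  inv_mem' {k} hk a b c := by
    simpa using (hk (k⁻¹ a) (k⁻¹ b) (k⁻¹ c)).symm

lemma mem_coboundaryAut {X : Type} {ε : X → X → ZMod 2} {k : Equiv.Perm X} :
    k ∈ coboundaryAut ε ↔ PreservesCoboundary ε ε k := by rfl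

/-- The restriction of a graph to a set of vertices. -/
abbrev induced {V : Type} (ε : V → V → ZMod 2) (B : Set V) (a b : B) : ZMod 2 := ε a b

lemma IsGraphFun.induced {V : Type} {ε : V → V → ZMod 2} (hε : IsGraphFun ε) (B : Set V) :
    IsGraphFun (induced ε B) :=
  ⟨fun a b => hε.symm a b, fun a => hε.diag a⟩

/-- The two-graph of `ε` contains every finite two-graph and is homogeneous. -/
structure IsUniversalHomogeneous {V : Type} (ε : V → V → ZMod 2) : Prop where
  isGraphFun : IsGraphFun ε
  universal : ∀ (W : Type) [Finite W] (δ : W → W → ZMod 2), IsGraphFun δ →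
    ∃ i : W ↪ V, PreservesCoboundary δ ε i
  homogeneous : ∀ (N : Type) [Finite N] (α β : N ↪ V),
    (∀ a b c, coboundary ε (α a) (α b) (α c) = coboundary ε (β a) (β b) (β c)) →
    ∃ g ∈ coboundaryAut ε, ∀ a, g (α a) = β a

/-- The extension graph of a finite set `B` of vertices embeds over `B`, with any given vertex in
its range. -/
lemma IsUniversalHomogeneous.exists_extGraph_embedding {V : Type} {ε : V → V → ZMod 2}
    (hU : IsUniversalHomogeneous ε) {B : Set V} (hB : B.Finite) (hne : B.Nonempty) (v : V) :
    ∃ j : B × (B → ZMod 2) ↪ V, PreservesCoboundary (extGraph (induced ε B)) ε j ∧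
      (∀ x, j (x, 0) = x) ∧ v ∈ Set.range j := by
  classical
  have hε := hU.isGraphFun
  have := hB.to_subtype
  have := hne.to_subtype
  have := (hB.insert v).to_subtype
  obtain ⟨i, hi⟩ := hU.universal _ _ (hε.induced B).extGraph
  obtain ⟨w, a, hw, hwa⟩ := exists_extGraph_type (induced ε B) (fun y => ε v y)
  let s : ↥(insert v B) → B × (B → ZMod 2) := fun z => if h : (z : V) ∈ B then (⟨z, h⟩, 0) else w
  have hv : ∀ z : ↥(insert v B), (z : V) ∉ B → (z : V) = v := fun z hz =>
    (Set.mem_insert_iff.1 z.2).resolve_right hz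
  have hsinj : Function.Injective s := by
    intro y z hyz
    simp only [s] at hyz
    apply Subtype.ext
    split_ifs at hyz with hy hz hz
    · simpa using hyz
    · exact absurd (congrArg Prod.snd hyz).symm hw
    · exact absurd (congrArg Prod.snd hyz) hw
    · rw [hv y hy, hv z hz]
  have hs : PreservesCoboundary (induced ε (insert v B)) (extGraph (induced ε B)) s := by
    refine .of_switching (fun z => if (z : V) ∈ B then 0 else a) fun y z => ?_
    simp only [s]
    split_ifs with hy hz hz
    · simp [extGraph]
    · rw [(hε.induced B).extGraph.symm, hwa, induced, hε.symm y z, hv z hz]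
      simp
    · rw [hwa, induced, hv y hy]
      simp
    · rw [(hε.induced B).extGraph.diag, induced, hv y hy, hv z hz, hε.diag]
      grind
  obtain ⟨g, hg, hgs⟩ := hU.homogeneous _ ((⟨s, hsinj⟩ : ↥(insert v B) ↪ _).trans i)
    (Function.Embedding.subtype _) (hi.comp hs)
  refine ⟨i.trans g.toEmbedding, (mem_coboundaryAut.1 hg).comp hi, fun x => ?_, ?_⟩
  · simpa [s] using hgs ⟨x, Set.mem_insert_of_mem _ x.2⟩
  · exact ⟨s ⟨v, Set.mem_insert _ _⟩, hgs ⟨v, Set.mem_insert _ _⟩⟩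

/-- Every finite set `B` of vertices has a finite extension to which the automorphisms of `B`
extend homomorphically, and all partial automorphisms of `B` extend. -/
lemma IsUniversalHomogeneous.exists_finite_extension {V : Type} {ε : V → V → ZMod 2}
    (hU : IsUniversalHomogeneous ε) (B : {B : Set V // B.Finite ∧ B.Nonempty}) (v : V) :
    ∃ (B' : {B : Set V // B.Finite ∧ B.Nonempty}) (hBB' : B.1 ⊆ B'.1)
      (θ : Equiv.Perm B.1 →* Equiv.Perm B'.1), v ∈ B'.1 ∧
      (∀ k (x : B.1), (θ k ⟨x, hBB' x.2⟩ : V) = k x) ∧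
      (∀ k ∈ coboundaryAut (induced ε B.1), θ k ∈ coboundaryAut (induced ε B'.1)) ∧
      ∀ g ∈ coboundaryAut ε, ∀ F ⊆ B.1, Set.MapsTo g F B.1 →
        ∃ h ∈ coboundaryAut (induced ε B'.1), ∀ x : B'.1, (x : V) ∈ F → (h x : V) = g x := by
  obtain ⟨B, hB, hne⟩ := B
  obtain ⟨j, hj, hjB, hv⟩ := hU.exists_extGraph_embedding hB hne v
  have := hB.to_subtype
  have hBB' : B ⊆ Set.range j := fun x hx => ⟨_, hjB ⟨x, hx⟩⟩
  let e : B × (B → ZMod 2) ≃ Set.range j := Equiv.ofInjective j j.injective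
  have hej : ∀ p, (e p : V) = j p := fun _ => rfl
  have hesymm : ∀ x (hx : x ∈ B), e.symm ⟨x, hBB' hx⟩ = (⟨x, hx⟩, 0) := fun x hx => by
    rw [Equiv.symm_apply_eq]
    exact Subtype.ext (hjB ⟨x, hx⟩).symm
  have hconj : ∀ h : Equiv.Perm (B × (B → ZMod 2)),
      PreservesCoboundary (extGraph (induced ε B)) (extGraph (induced ε B)) h →
      e.permCongr h ∈ coboundaryAut (induced ε (Set.range j)) := by
    intro h hh
    refine mem_coboundaryAut.2 fun a b c => ?_
    obtain ⟨a, rfl⟩ := e.surjective a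
    obtain ⟨b, rfl⟩ := e.surjective b
    obtain ⟨c, rfl⟩ := e.surjective c
    simp only [Equiv.permCongr_apply, Equiv.symm_apply_apply]
    exact (hj _ _ _).trans ((hh a b c).trans (hj a b c).symm)
  refine ⟨⟨Set.range j, Set.finite_range j, hne.mono hBB'⟩, hBB',
    (e.permCongrHom : _ →* _).comp (extPerm B), hv, fun k x => ?_, fun k hk => ?_, ?_⟩
  · change (e (extPerm B k (e.symm ⟨x, hBB' x.2⟩)) : V) = k x
    rw [hesymm x x.2, hej]
    exact hjB (k x)
  · exact hconj _ (mem_coboundaryAut.1 hk).extPerm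
  · intro g hg F hF hgF
    classical
    obtain ⟨c, hc⟩ := (mem_coboundaryAut.1 hg).exists_switching
    obtain ⟨h, hh, hhF⟩ := exists_extGraph_automorphism (hU.isGraphFun.induced B)
      {x | (x : V) ∈ F} (fun x => if hx : g x ∈ B then ⟨g x, hx⟩ else x)
      (fun x hx y hy hxy => by
        dsimp only at hxy
        rw [dif_pos (hgF hx), dif_pos (hgF hy), Subtype.mk.injEq] at hxy
        exact Subtype.ext (g.injective hxy))
      (fun x => c x)
      (fun x hx y hy => by
        rw [dif_pos (hgF hx), dif_pos (hgF hy)]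
        exact hc x y)
    refine ⟨_, hconj h hh, fun x hx => ?_⟩
    change (e (h (e.symm ⟨x, _⟩)) : V) = g x
    rw [hesymm x (hF hx), hej, hhF ⟨x, hF hx⟩ hx, hjB, dif_pos (hgF hx)]

/-- Compatible group homomorphisms between the permutation groups of an exhausting chain of subsets
have a limit. -/
lemma exists_limit_permHom {V : Type} (B : ℕ → Set V) (hcov : ∀ v, ∃ n, v ∈ B n)
    (hB : ∀ n, B n ⊆ B (n + 1)) (θ : ∀ n, Equiv.Perm (B n) →* Equiv.Perm (B (n + 1)))
    (hθ : ∀ n k (x : B n), (θ n k ⟨x, hB n x.2⟩ : V) = k x) :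
    ∃ Φ : ∀ n, Equiv.Perm (B n) →* Equiv.Perm V, (∀ n k (x : B n), Φ n k x = k x) ∧
      ∀ n k, Φ (n + 1) (θ n k) = Φ n k := by
  have hmono : Monotone B := monotone_nat_of_le_succ hB
  let iter : ∀ n j, Equiv.Perm (B n) →* Equiv.Perm (B (n + j)) := fun n j =>
    Nat.rec (motive := fun j => Equiv.Perm (B n) →* Equiv.Perm (B (n + j)))
      (MonoidHom.id _) (fun j f => (θ (n + j)).comp f) j
  have iter_succ : ∀ n j k, iter n (j + 1) k = θ (n + j) (iter n j k) := fun _ _ _ => rfl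
  have iter_le : ∀ n k j j', j ≤ j' → ∀ x (hx : x ∈ B (n + j)) (hx' : x ∈ B (n + j')),
      (iter n j' k ⟨x, hx'⟩ : V) = iter n j k ⟨x, hx⟩ := by
    intro n k j j' hjj'
    induction j', hjj' using Nat.le_induction with
    | base => exact fun _ _ _ => rfl
    | succ m hm ih =>
      intro x hx hx'
      rw [← ih x hx (hmono (by omega) hx)]
      exact hθ (n + m) (iter n m k) ⟨x, _⟩
  have hJ : ∀ n v, ∃ j, v ∈ B (n + j) := fun n v =>
    (hcov v).imp fun j hj => hmono (by omega) hj
  choose J hJ using hJ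
  let act : ∀ n, Equiv.Perm (B n) → V → V := fun n k x => iter n (J n x) k ⟨x, hJ n x⟩
  have hact : ∀ n k j x (hx : x ∈ B (n + j)), act n k x = iter n j k ⟨x, hx⟩ := by
    intro n k j x hx
    rcases le_total j (J n x) with h | h
    · exact iter_le n k _ _ h x _ _
    · exact (iter_le n k _ _ h x _ _).symm
  have act_one : ∀ n x, act n 1 x = x := fun n x => by simp only [act, map_one]; rfl
  have act_mul : ∀ n k l x, act n (k * l) x = act n k (act n l x) := by
    intro n k l x
    rw [hact n l _ x (hJ n x), hact n k _ _ (Subtype.prop _), hact n _ _ x (hJ n x), map_mul]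
    rfl
  let Φ : ∀ n, Equiv.Perm (B n) →* Equiv.Perm V := fun n =>
    { toFun := fun k => ⟨act n k, act n k⁻¹, fun x => by rw [← act_mul, inv_mul_cancel, act_one],
        fun x => by rw [← act_mul, mul_inv_cancel, act_one]⟩
      map_one' := Equiv.ext (act_one n)
      map_mul' := fun k l => Equiv.ext (act_mul n k l) }
  refine ⟨Φ, fun n k x => hact n k 0 x x.2, fun n k => Equiv.ext fun x => ?_⟩
  have θ_heq : ∀ m m' (a : Equiv.Perm (B m)) (b : Equiv.Perm (B m')), m = m' → a ≍ b →
      θ m a ≍ θ m' b := by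
    rintro m _ a _ rfl ⟨⟩
    rfl
  have iter_heq : ∀ j, iter (n + 1) j (θ n k) ≍ iter n (j + 1) k := by
    intro j
    induction j with
    | zero => rfl
    | succ j ih => exact θ_heq _ _ _ _ (by omega) ih
  have apply_eq : ∀ m m' (a : Equiv.Perm (B m)) (b : Equiv.Perm (B m')), m = m' → a ≍ b →
      ∀ (h : x ∈ B m) (h' : x ∈ B m'), (a ⟨x, h⟩ : V) = b ⟨x, h'⟩ := by
    rintro m _ a _ rfl ⟨⟩ _ _
    rfl
  change act (n + 1) (θ n k) x = act n k x
  have h := hJ (n + 1) x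
  have h' : x ∈ B (n + (J (n + 1) x + 1)) := hmono (by omega) h
  rw [hact _ _ _ x h, hact _ _ _ x h']
  exact apply_eq _ _ _ _ (by omega) (iter_heq _) _ _

/-- The automorphism group of a countable universal homogeneous two-graph has a dense locally
finite subgroup. -/
lemma IsUniversalHomogeneous.exists_dense_locally_finite {V : Type} [Countable V] [Nonempty V]
    {ε : V → V → ZMod 2} (hU : IsUniversalHomogeneous ε) :
    ∃ H : Subgroup (Equiv.Perm V), H ≤ coboundaryAut ε ∧
      (∀ S : Set (Equiv.Perm V), S.Finite → S ⊆ H →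
        ((Subgroup.closure S : Subgroup (Equiv.Perm V)) : Set (Equiv.Perm V)).Finite) ∧
      ∀ g ∈ coboundaryAut ε, ∀ F : Set V, F.Finite → ∃ h ∈ H, ∀ x ∈ F, h x = g x := by
  obtain ⟨o⟩ := ‹Nonempty V›
  obtain ⟨enum, henum⟩ := exists_surjective_nat V
  choose next hsub θ hmem hθ hθaut hpart using hU.exists_finite_extension
  let C : ℕ → {B : Set V // B.Finite ∧ B.Nonempty} := fun n =>
    Nat.rec ⟨{o}, Set.finite_singleton o, Set.singleton_nonempty o⟩ (fun n B => next B (enum n)) n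
  let B : ℕ → Set V := fun n => (C n).1
  have hsucc : ∀ n, B n ⊆ B (n + 1) := fun n => hsub (C n) (enum n)
  have hmono : Monotone B := monotone_nat_of_le_succ hsucc
  have hcov : ∀ v, ∃ n, v ∈ B n := fun v => by
    obtain ⟨n, rfl⟩ := henum v
    exact ⟨n + 1, hmem (C n) (enum n)⟩
  have hfin : ∀ F : Set V, F.Finite → ∃ n, F ⊆ B n := fun F hF => by
    induction F, hF using Set.Finite.induction_on with
    | empty => exact ⟨0, Set.empty_subset _⟩
    | @insert v F _ _ ih =>
      obtain ⟨m, hm⟩ := ih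
      obtain ⟨n, hn⟩ := hcov v
      exact ⟨max m n, Set.insert_subset (hmono (le_max_right _ _) hn)
        (hm.trans (hmono (le_max_left _ _)))⟩
  obtain ⟨Φ, hΦ, hΦθ⟩ := exists_limit_permHom B hcov hsucc (fun n => θ (C n) (enum n))
    (fun n => hθ (C n) (enum n))
  let A : ℕ → Subgroup (Equiv.Perm V) := fun n => (coboundaryAut (induced ε (B n))).map (Φ n)
  have hA : Monotone A := by
    refine monotone_nat_of_le_succ fun n => ?_
    rintro _ ⟨k, hk, rfl⟩
    exact ⟨_, hθaut (C n) (enum n) k hk, hΦθ n k⟩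
  have hAfin : ∀ n, (A n : Set (Equiv.Perm V)).Finite := fun n => by
    have : Finite (B n) := (C n).2.1.to_subtype
    exact (Set.toFinite _).image _
  have mem_iSup : ∀ g, g ∈ (⨆ n, A n) ↔ ∃ n, g ∈ A n := fun g =>
    Subgroup.mem_iSup_of_directed hA.directed_le
  refine ⟨⨆ n, A n, iSup_le fun n => ?_, fun S hS hSA => ?_, fun g hg F hF => ?_⟩
  · refine fun g hg => mem_coboundaryAut.2 fun a b c => ?_
    obtain ⟨m, hm⟩ := hfin {a, b, c} (by simp)
    obtain ⟨k, hk, rfl⟩ := hA (le_max_left n m) hg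
    have hsub := hm.trans (hmono (le_max_right n m))
    have ha : a ∈ B (max n m) := hsub (by simp)
    have hb : b ∈ B (max n m) := hsub (by simp)
    have hc : c ∈ B (max n m) := hsub (by simp)
    have := mem_coboundaryAut.1 hk ⟨a, ha⟩ ⟨b, hb⟩ ⟨c, hc⟩
    have ea := hΦ _ k ⟨a, ha⟩
    have eb := hΦ _ k ⟨b, hb⟩
    have ec := hΦ _ k ⟨c, hc⟩
    dsimp only at ea eb ec
    rw [ea, eb, ec]
    exact this
  · have : ∃ n, S ⊆ A n := by
      induction S, hS using Set.Finite.induction_on with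
      | empty => exact ⟨0, Set.empty_subset _⟩
      | @insert g S _ _ ih =>
        obtain ⟨m, hm⟩ := ih ((Set.subset_insert _ _).trans hSA)
        obtain ⟨n, hn⟩ := (mem_iSup g).1 (hSA (Set.mem_insert _ _))
        exact ⟨max m n, Set.insert_subset (hA (le_max_right _ _) hn)
          (hm.trans (hA (le_max_left _ _)))⟩
    obtain ⟨n, hn⟩ := this
    exact (hAfin n).subset ((Subgroup.closure_le _).2 hn)
  · obtain ⟨n, hn⟩ := hfin (F ∪ g '' F) (hF.union (hF.image g))
    obtain ⟨h, hh, hhF⟩ := hpart (C n) (enum n) g hg F (Set.subset_union_left.trans hn)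
      (fun x hx => hn (Or.inr ⟨x, hx, rfl⟩))
    refine ⟨Φ (n + 1) h, (mem_iSup _).2 ⟨n + 1, h, hh, rfl⟩, fun x hx => ?_⟩
    have hx' : x ∈ B (n + 1) := hsucc n (hn (Or.inl hx))
    exact (hΦ (n + 1) h ⟨x, hx'⟩).trans (hhF ⟨x, hx'⟩ hx)

/-- If `𝕋 = (V, T)` is a countably infinite two-graph which is universal for
finite two-graphs and homogeneous (every isomorphism between finite induced
sub-two-graphs extends to an automorphism), then `Aut(𝕋)` contains a locally
finite subgroup `H` which is dense: every automorphism agrees with some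
element of `H` on any finite set of vertices. -/
theorem dense_locally_finite_subgroup (V : Type) [Countable V] [Infinite V]
    (T : Set (Finset V)) (hT : IsTwoGraphSet T)
    (huniv : ∀ (W : Type) [Fintype W] (TW : Set (Finset W)), IsTwoGraphSet TW →
      ∃ i : W ↪ V, ∀ a b c : W, a ≠ b → a ≠ c → b ≠ c →
        (tri a b c ∈ TW ↔ tri (i a) (i b) (i c) ∈ T))
    (hhom : ∀ p : Set (V × V), p.Finite → IsPartialTGIso T p →
      ∃ g : Equiv.Perm V, IsTGAut T g ∧ ∀ u ∈ p, g u.1 = u.2) :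
    ∃ H : Subgroup (Equiv.Perm V),
      (∀ g ∈ H, IsTGAut T g) ∧
      (∀ S : Set (Equiv.Perm V), S.Finite → S ⊆ H →
        ((Subgroup.closure S : Subgroup (Equiv.Perm V)) :
          Set (Equiv.Perm V)).Finite) ∧
      (∀ g : Equiv.Perm V, IsTGAut T g → ∀ F : Finset V,
        ∃ h ∈ H, ∀ x ∈ F, h x = g x) := by
  obtain ⟨ε, hε, hTε⟩ := hT.exists_graphFun
  have haut : ∀ g : Equiv.Perm V, IsTGAut T g ↔ g ∈ coboundaryAut ε := fun g => by
    simp only [IsTGAut, mem_coboundaryAut, PreservesCoboundary, zmod_two_eq_iff, ← hTε]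
  have hU : IsUniversalHomogeneous ε := by
    refine ⟨hε, fun W _ δ hδ => ?_, fun N _ α β hαβ => ?_⟩
    · have := Fintype.ofFinite W
      obtain ⟨TW, hTW, hTWδ⟩ := hδ.exists_isTwoGraphSet
      obtain ⟨i, hi⟩ := huniv W TW hTW
      refine ⟨i, fun a b c => ?_⟩
      by_cases h : a ≠ b ∧ a ≠ c ∧ b ≠ c
      · rw [zmod_two_eq_iff, ← hTε, ← hTWδ]
        exact (hi a b c h.1 h.2.1 h.2.2).symm
      · rw [hδ.coboundary_eq_zero h, hε.coboundary_eq_zero (by simpa using h)]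
    · obtain ⟨g, hg, hgp⟩ := hhom (Set.range fun a => (α a, β a)) (Set.finite_range _) <| by
        constructor
        · rintro _ ⟨a, rfl⟩ _ ⟨b, rfl⟩
          simp
        · rintro _ ⟨a, rfl⟩ _ ⟨b, rfl⟩ _ ⟨c, rfl⟩
          rw [hTε, hTε, hαβ]
      exact ⟨g, (haut g).1 hg, fun a => hgp _ ⟨a, rfl⟩⟩
  obtain ⟨H, hH, hfin, hdense⟩ := hU.exists_dense_locally_finite
  exact ⟨H, fun g hg => (haut g).2 (hH hg), hfin,
    fun g hg F => hdense g ((haut g).1 hg) F F.finite_toSet⟩
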